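/- arXiv:2401.17556 — 2 statements merged into one kernel-verified Lean document; each statement's English description precedes it below -/
import Mathlib

section
/- (Convergence of Constituents, explicit Hintikka posterior with λ(w) = w and α = 0.) Fix natural numbers c and K with 1 ≤ c ≤ K. For each sample size n define the posterior probability of the minimal constituent C_c as P(n) = (1/(c⁽ⁿ⁾)) / ( Σ_{i=0}^{K−c} C(K−c, i) · (1/((c+i)⁽ⁿ⁾)) ), where m⁽ⁿ⁾ = m(m+1)⋯(m+n−1) is the ascending factorial and C(·,·) is the binomial coefficient, all interpreted as real numbers. Then P(n) → 1 as n → ∞. -/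
open Filter Finset

/-- The ascending factorial `m⁽ⁿ⁾ = m (m+1) ⋯ (m+n-1)`, as a real number. -/
noncomputable def ascFac (m n : ℕ) : ℝ :=
  ∏ j ∈ Finset.range n, ((m : ℝ) + j)

theorem ascFac_pos {m : ℕ} (hm : 0 < m) (n : ℕ) : 0 < ascFac m n :=
  Finset.prod_pos fun _ _ => by positivity

theorem ascFac_le_ascFac {m m' : ℕ} (h : m ≤ m') (n : ℕ) : ascFac m n ≤ ascFac m' n := by
  unfold ascFac
  gcongr

theorem mul_ascFac_succ (m n : ℕ) : (m : ℝ) * ascFac (m + 1) n = ascFac m n * (m + n) := by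
  have h₁ := Finset.prod_range_succ (fun j : ℕ => (m : ℝ) + j) n
  have h₂ := Finset.prod_range_succ' (fun j : ℕ => (m : ℝ) + j) n
  unfold ascFac
  rw [← h₁, h₂, mul_comm]
  simp [add_assoc, add_comm (1 : ℝ)]

theorem tendsto_ascFac_div_ascFac_of_lt {m m' : ℕ} (hm : 0 < m) (h : m < m') :
    Tendsto (fun n => ascFac m n / ascFac m' n) atTop (nhds 0) := by
  have hlim : Tendsto (fun n : ℕ => (m : ℝ) / (m + n)) atTop (nhds 0) :=
    (tendsto_atTop_add_const_left _ _ tendsto_natCast_atTop_atTop).const_div_atTop _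
  refine squeeze_zero
    (fun n => (div_pos (ascFac_pos hm n) (ascFac_pos (hm.trans h) n)).le) (fun n => ?_) hlim
  rw [div_le_div_iff₀ (ascFac_pos (hm.trans h) n) (by positivity), ← mul_ascFac_succ]
  gcongr
  exact ascFac_le_ascFac h n

/-- Convergence of Constituents, explicit Hintikka posterior with
`λ(w) = w` and `α = 0`: for `1 ≤ c ≤ K`, the posterior probability of the minimal
constituent `C_c`,
`P(n) = (1/c⁽ⁿ⁾) / (∑_{i=0}^{K-c} C(K-c, i) · (1/(c+i)⁽ⁿ⁾))`,
tends to `1` as the sample size `n` tends to infinity. -/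
theorem posterior_minimal_constituent_tendsto_one (c K : ℕ) (hc : 1 ≤ c) (hcK : c ≤ K) :
    Tendsto
      (fun n : ℕ =>
        (1 / ascFac c n) /
          ∑ i ∈ Finset.range (K - c + 1), ((K - c).choose i : ℝ) * (1 / ascFac (c + i) n))
      atTop (nhds 1) := by
  have hterm (i : ℕ) : Tendsto (fun n => ascFac c n / ascFac (c + i) n) atTop
      (nhds (if i = 0 then 1 else 0)) := by
    split_ifs with hi
    · subst hi
      simp [div_self (ascFac_pos hc _).ne']
    · exact tendsto_ascFac_div_ascFac_of_lt hc (by omega)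
  have hsum := tendsto_finsetSum (Finset.range (K - c + 1))
    fun i _ => (hterm i).const_mul ((K - c).choose i : ℝ)
  have hval : ∑ i ∈ Finset.range (K - c + 1),
      ((K - c).choose i : ℝ) * (if i = 0 then 1 else 0) = 1 := by simp
  rw [hval] at hsum
  convert hsum.inv₀ one_ne_zero using 2 with n
  · rw [div_div, one_div, Finset.mul_sum]
    congr 1
    exact Finset.sum_congr rfl fun i _ => by ring
  · simp
end

section
/- (Convergence of the α-parametrized posterior.) Fix natural numbers c, K, α with 1 ≤ c ≤ K. Define for each n > α the real number P(n) = c^{α−n} / ( Σ_{i=0}^{K−c} C(K−c, i) · (c+i)^{α−n} ). Then P(n) → 1 as n → ∞. -/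
open Filter Finset

/-- The Hintikka posterior probability of the minimal constituent `C_c` given evidence
of size `n`, with prior parameter `α`:
`P(n) = c^(α-n) / (∑_{i=0}^{K-c} C(K-c, i) · (c+i)^(α-n))`, as a real number. -/
noncomputable def minimalPosterior (c K α n : ℕ) : ℝ :=
  (c : ℝ) ^ ((α : ℤ) - n) /
    ∑ i ∈ Finset.range (K - c + 1),
      ((K - c).choose i : ℝ) * ((c : ℝ) + i) ^ ((α : ℤ) - n)

theorem minimalPosterior_eq_inv_sum (c K α n : ℕ) :
    minimalPosterior c K α n =
      (∑ i ∈ Finset.range (K - c + 1),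
        ((K - c).choose i : ℝ) * (((c : ℝ) + i) / c) ^ ((α : ℤ) - n))⁻¹ := by
  simp only [minimalPosterior, div_zpow, ← mul_div_assoc]
  rw [← Finset.sum_div, inv_div]

theorem tendsto_zpow_sub_natCast_atTop_zero {r : ℝ} (hr : 1 < r) (m : ℤ) :
    Tendsto (fun n : ℕ => r ^ (m - n)) atTop (nhds 0) := by
  have hr0 : r ≠ 0 := by positivity
  have h := (tendsto_pow_atTop_nhds_zero_of_lt_one (by positivity : 0 ≤ r⁻¹)
    (inv_lt_one_of_one_lt₀ hr)).const_mul (r ^ m)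
  rw [mul_zero] at h
  refine h.congr fun n => ?_
  rw [zpow_sub₀ hr0, zpow_natCast, inv_pow, div_eq_mul_inv]

/-- Convergence of the α-parametrized posterior: for `1 ≤ c ≤ K` and
fixed `α`, the posterior `P(n) = c^(α-n) / (∑_{i=0}^{K-c} C(K-c, i) (c+i)^(α-n))`
tends to `1` as the sample size `n` tends to infinity. -/
theorem minimalPosterior_tendsto_one (c K α : ℕ) (hc : 1 ≤ c) (hcK : c ≤ K) :
    Tendsto (fun n : ℕ => minimalPosterior c K α n) atTop (nhds 1) := by
  have hc0 : (0 : ℝ) < c := by exact_mod_cast hc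
  have hsum : Tendsto (fun n : ℕ => ∑ i ∈ Finset.range (K - c + 1),
      ((K - c).choose i : ℝ) * (((c : ℝ) + i) / c) ^ ((α : ℤ) - n)) atTop
      (nhds (∑ i ∈ Finset.range (K - c + 1), if i = 0 then 1 else 0)) := by
    refine tendsto_finsetSum _ fun i _ => ?_
    split_ifs with hi
    · simp [hi, hc0.ne']
    · have hi0 : (0 : ℝ) < i := by exact_mod_cast Nat.pos_of_ne_zero hi
      have hr : 1 < ((c : ℝ) + i) / c := by
        rw [one_lt_div hc0]
        linarith
      simpa using (tendsto_zpow_sub_natCast_atTop_zero hr α).const_mul ((K - c).choose i : ℝ)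
  simp only [minimalPosterior_eq_inv_sum]
  simpa using hsum.inv₀ (by simp)
end
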